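/- Correctness of bidirectional inference for CCω: if ⊢ Γ and Γ ⊢ t ▹ T, then Γ ⊢ t : T. -/

import Mathlib

/-! Formalization of CCω (terms, reduction, conversion, undirected and
bidirectional typing, cumulativity) using de Bruijn indices, following
Lennon-Bertrand, "Complete Bidirectional Typing for the Calculus of
Inductive Constructions". -/

namespace CComega

/-- Terms of CCω: `t ::= x | □_i | Πx:t.t | λx:t.t | t t`,
with variables as de Bruijn indices. -/
inductive Tm : Type
  | var : ℕ → Tm
  | sort : ℕ → Tm
  | pi : Tm → Tm → Tm
  | lam : Tm → Tm → Tm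
  | app : Tm → Tm → Tm
deriving DecidableEq

/-- `lift n k t` shifts by `n` the de Bruijn indices of `t` that are ≥ `k`. -/
def lift (n k : ℕ) : Tm → Tm
  | .var i => if i < k then .var i else .var (i + n)
  | .sort i => .sort i
  | .pi A B => .pi (lift n k A) (lift n (k + 1) B)
  | .lam A t => .lam (lift n k A) (lift n (k + 1) t)
  | .app t u => .app (lift n k t) (lift n k u)

/-- `subst u k t` is the capture-avoiding substitution `t[u/k]` of `u`
for de Bruijn index `k` in `t`. -/
def subst (u : Tm) (k : ℕ) : Tm → Tm
  | .var i => if i < k then .var i else if i = k then lift k 0 u else .var (i - 1)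
  | .sort i => .sort i
  | .pi A B => .pi (subst u k A) (subst u (k + 1) B)
  | .lam A t => .lam (subst u k A) (subst u (k + 1) t)
  | .app t v => .app (subst u k t) (subst u k v)

/-- One-step reduction `t → t'`: the least congruence such that
`(λx:A.t) u → t[u/x]`. -/
inductive Red : Tm → Tm → Prop
  | beta (A t u : Tm) : Red (.app (.lam A t) u) (subst u 0 t)
  | piDom {A A'} (B : Tm) : Red A A' → Red (.pi A B) (.pi A' B)
  | piCod (A : Tm) {B B'} : Red B B' → Red (.pi A B) (.pi A B')
  | lamDom {A A'} (t : Tm) : Red A A' → Red (.lam A t) (.lam A' t)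
  | lamBody (A : Tm) {t t'} : Red t t' → Red (.lam A t) (.lam A t')
  | appFun {t t'} (u : Tm) : Red t t' → Red (.app t u) (.app t' u)
  | appArg (t : Tm) {u u'} : Red u u' → Red (.app t u) (.app t u')

/-- Multi-step reduction `t ↠ t'`: reflexive-transitive closure of `→`. -/
def Reds : Tm → Tm → Prop := Relation.ReflTransGen Red

/-- Conversion `t ≡ u`: symmetric, reflexive, transitive closure of `→`. -/
def Conv : Tm → Tm → Prop := Relation.EqvGen Red

/-- Contexts are lists of (de Bruijn) declarations, most recent first. -/
abbrev Ctx := List Tm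

mutual
/-- Context well-formedness `⊢ Γ`. -/
inductive WfCtx : Ctx → Prop
  | nil : WfCtx []
  | cons {Γ A i} : WfCtx Γ → Typed Γ A (.sort i) → WfCtx (A :: Γ)

/-- Undirected typing `Γ ⊢ t : T`. -/
inductive Typed : Ctx → Tm → Tm → Prop
  | sort {Γ i} : WfCtx Γ → Typed Γ (.sort i) (.sort (i + 1))
  | var {Γ n A} : WfCtx Γ → Γ[n]? = some A → Typed Γ (.var n) (lift (n + 1) 0 A)
  | pi {Γ A B i j} : Typed Γ A (.sort i) → Typed (A :: Γ) B (.sort j) →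
      Typed Γ (.pi A B) (.sort (max i j))
  | lam {Γ A B t i} : Typed Γ (.pi A B) (.sort i) → Typed (A :: Γ) t B →
      Typed Γ (.lam A t) (.pi A B)
  | app {Γ t u A B} : Typed Γ t (.pi A B) → Typed Γ u A →
      Typed Γ (.app t u) (subst u 0 B)
  | conv {Γ t A B i} : Typed Γ t A → Typed Γ B (.sort i) → Conv A B →
      Typed Γ t B
end

mutual
/-- Bidirectional inference `Γ ⊢ t ▹ T`. -/
inductive Infer : Ctx → Tm → Tm → Prop
  | sort {Γ i} : Infer Γ (.sort i) (.sort (i + 1))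
  | var {Γ n A} : Γ[n]? = some A → Infer Γ (.var n) (lift (n + 1) 0 A)
  | pi {Γ A B i j} : InferSort Γ A (.sort i) → InferSort (A :: Γ) B (.sort j) →
      Infer Γ (.pi A B) (.sort (max i j))
  | lam {Γ A t B i} : InferSort Γ A (.sort i) → Infer (A :: Γ) t B →
      Infer Γ (.lam A t) (.pi A B)
  | app {Γ t u A B} : InferPi Γ t (.pi A B) → Check Γ u A →
      Infer Γ (.app t u) (subst u 0 B)

/-- Bidirectional checking `Γ ⊢ t ◃ T`. -/
inductive Check : Ctx → Tm → Tm → Prop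
  | check {Γ t T T'} : Infer Γ t T' → Conv T' T → Check Γ t T

/-- Constrained inference `Γ ⊢ t ▹_□ T` (the output is a universe). -/
inductive InferSort : Ctx → Tm → Tm → Prop
  | inferSort {Γ t T i} : Infer Γ t T → Reds T (.sort i) → InferSort Γ t (.sort i)

/-- Constrained inference `Γ ⊢ t ▹_Π T` (the output is a product type). -/
inductive InferPi : Ctx → Tm → Tm → Prop
  | inferPi {Γ t T A B} : Infer Γ t T → Reds T (.pi A B) → InferPi Γ t (.pi A B)
end

/-- Weak-head reduction `t ⇝ t'`: reduction only at the head. -/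
inductive WhRed : Tm → Tm → Prop
  | beta (A t u : Tm) : WhRed (.app (.lam A t) u) (subst u 0 t)
  | appFun {t t'} (u : Tm) : WhRed t t' → WhRed (.app t u) (.app t' u)

/-- Multi-step weak-head reduction `t ⇝* t'`. -/
def WhReds : Tm → Tm → Prop := Relation.ReflTransGen WhRed

mutual
/-- Weak-head bidirectional inference: as `Infer`, but constrained inference
uses weak-head reduction. -/
inductive InferW : Ctx → Tm → Tm → Prop
  | sort {Γ i} : InferW Γ (.sort i) (.sort (i + 1))
  | var {Γ n A} : Γ[n]? = some A → InferW Γ (.var n) (lift (n + 1) 0 A)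
  | pi {Γ A B i j} : InferSortW Γ A (.sort i) → InferSortW (A :: Γ) B (.sort j) →
      InferW Γ (.pi A B) (.sort (max i j))
  | lam {Γ A t B i} : InferSortW Γ A (.sort i) → InferW (A :: Γ) t B →
      InferW Γ (.lam A t) (.pi A B)
  | app {Γ t u A B} : InferPiW Γ t (.pi A B) → CheckW Γ u A →
      InferW Γ (.app t u) (subst u 0 B)

/-- Weak-head bidirectional checking. -/
inductive CheckW : Ctx → Tm → Tm → Prop
  | check {Γ t T T'} : InferW Γ t T' → Conv T' T → CheckW Γ t T

/-- Weak-head constrained inference `Γ ⊢ t ▹_□ T`. -/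
inductive InferSortW : Ctx → Tm → Tm → Prop
  | inferSort {Γ t T i} : InferW Γ t T → WhReds T (.sort i) →
      InferSortW Γ t (.sort i)

/-- Weak-head constrained inference `Γ ⊢ t ▹_Π T`. -/
inductive InferPiW : Ctx → Tm → Tm → Prop
  | inferPi {Γ t T A B} : InferW Γ t T → WhReds T (.pi A B) →
      InferPiW Γ t (.pi A B)
end

/-- Cumulativity `t ≼ u`: the least transitive relation containing conversion
such that `□_i ≼ □_j` whenever `i ≤ j` and `Πx:A.B ≼ Πx:A'.B'` whenever
`A ≡ A'` and `B ≼ B'`. -/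
inductive Cum : Tm → Tm → Prop
  | ofConv {t u} : Conv t u → Cum t u
  | sort {i j : ℕ} : i ≤ j → Cum (.sort i) (.sort j)
  | pi {A A' B B'} : Conv A A' → Cum B B' → Cum (.pi A B) (.pi A' B')
  | trans {t u v} : Cum t u → Cum u v → Cum t v

mutual
/-- Context well-formedness for the cumulative undirected system. -/
inductive WfCtxC : Ctx → Prop
  | nil : WfCtxC []
  | cons {Γ A i} : WfCtxC Γ → TypedC Γ A (.sort i) → WfCtxC (A :: Γ)

/-- Cumulative undirected typing `Γ ⊢ t : T`: as `Typed`, with the conversion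
rule replaced by cumulativity. -/
inductive TypedC : Ctx → Tm → Tm → Prop
  | sort {Γ i} : WfCtxC Γ → TypedC Γ (.sort i) (.sort (i + 1))
  | var {Γ n A} : WfCtxC Γ → Γ[n]? = some A → TypedC Γ (.var n) (lift (n + 1) 0 A)
  | pi {Γ A B i j} : TypedC Γ A (.sort i) → TypedC (A :: Γ) B (.sort j) →
      TypedC Γ (.pi A B) (.sort (max i j))
  | lam {Γ A B t i} : TypedC Γ (.pi A B) (.sort i) → TypedC (A :: Γ) t B →
      TypedC Γ (.lam A t) (.pi A B)
  | app {Γ t u A B} : TypedC Γ t (.pi A B) → TypedC Γ u A →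
      TypedC Γ (.app t u) (subst u 0 B)
  | cumul {Γ t A B i} : TypedC Γ t A → TypedC Γ B (.sort i) → Cum A B →
      TypedC Γ t B
end

mutual
/-- Cumulative bidirectional inference `Γ ⊢ t ▹ T`. -/
inductive InferC : Ctx → Tm → Tm → Prop
  | sort {Γ i} : InferC Γ (.sort i) (.sort (i + 1))
  | var {Γ n A} : Γ[n]? = some A → InferC Γ (.var n) (lift (n + 1) 0 A)
  | pi {Γ A B i j} : InferSortC Γ A (.sort i) → InferSortC (A :: Γ) B (.sort j) →
      InferC Γ (.pi A B) (.sort (max i j))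
  | lam {Γ A t B i} : InferSortC Γ A (.sort i) → InferC (A :: Γ) t B →
      InferC Γ (.lam A t) (.pi A B)
  | app {Γ t u A B} : InferPiC Γ t (.pi A B) → CheckC Γ u A →
      InferC Γ (.app t u) (subst u 0 B)

/-- Cumulative bidirectional checking `Γ ⊢ t ◃ T`, using cumulativity. -/
inductive CheckC : Ctx → Tm → Tm → Prop
  | check {Γ t T T'} : InferC Γ t T' → Cum T' T → CheckC Γ t T

/-- Cumulative constrained inference `Γ ⊢ t ▹_□ T` (unchanged: uses reduction). -/
inductive InferSortC : Ctx → Tm → Tm → Prop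
  | inferSort {Γ t T i} : InferC Γ t T → Reds T (.sort i) → InferSortC Γ t (.sort i)

/-- Cumulative constrained inference `Γ ⊢ t ▹_Π T` (unchanged: uses reduction). -/
inductive InferPiC : Ctx → Tm → Tm → Prop
  | inferPi {Γ t T A B} : InferC Γ t T → Reds T (.pi A B) → InferPiC Γ t (.pi A B)
end

/-! ### Parallel renamings and substitutions -/

/-- Extension of a renaming under a binder. -/
def upRen (ρ : ℕ → ℕ) : ℕ → ℕ
  | 0 => 0
  | n + 1 => ρ n + 1

/-- Application of a renaming to a term. -/
def ren (ρ : ℕ → ℕ) : Tm → Tm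
  | .var i => .var (ρ i)
  | .sort i => .sort i
  | .pi A B => .pi (ren ρ A) (ren (upRen ρ) B)
  | .lam A t => .lam (ren ρ A) (ren (upRen ρ) t)
  | .app t u => .app (ren ρ t) (ren ρ u)

/-- Extension of a parallel substitution under a binder. -/
def up (σ : ℕ → Tm) : ℕ → Tm
  | 0 => .var 0
  | n + 1 => ren Nat.succ (σ n)

/-- Application of a parallel substitution to a term. -/
def sub (σ : ℕ → Tm) : Tm → Tm
  | .var i => σ i
  | .sort i => .sort i
  | .pi A B => .pi (sub σ A) (sub (up σ) B)
  | .lam A t => .lam (sub σ A) (sub (up σ) t)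
  | .app t u => .app (sub σ t) (sub σ u)

/-- The parallel substitution replacing index `0` by `u` and lowering the other indices. -/
def single (u : Tm) : ℕ → Tm
  | 0 => u
  | n + 1 => .var n

theorem lift_eq_ren (n k : ℕ) (t : Tm) :
    lift n k t = ren (fun i => if i < k then i else i + n) t := by
  have hup : ∀ k, (fun i => if i < k + 1 then i else i + n) =
      upRen (fun i => if i < k then i else i + n) := by
    intro k
    funext i
    cases i with
    | zero => simp [upRen]
    | succ i => simp only [upRen, Nat.add_lt_add_iff_right]; split <;> omega
  induction t generalizing k with
  | var i => simp only [lift, ren]; split <;> rfl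
  | sort i => rfl
  | pi A B ihA ihB => simp only [lift, ren, ihA, ihB, hup]
  | lam A B ihA ihB => simp only [lift, ren, ihA, ihB, hup]
  | app A B ihA ihB => simp only [lift, ren, ihA, ihB]

theorem lift_zero_eq_ren (n : ℕ) (t : Tm) : lift n 0 t = ren (· + n) t := by
  simp [lift_eq_ren]

theorem upRen_id : upRen (fun i => i) = fun i => i := by
  funext i; cases i <;> rfl

theorem ren_id (t : Tm) : ren (fun i => i) t = t := by
  induction t with
  | var i => rfl
  | sort i => rfl
  | pi A B ihA ihB => simp only [ren, upRen_id, ihA, ihB]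
  | lam A B ihA ihB => simp only [ren, upRen_id, ihA, ihB]
  | app A B ihA ihB => simp only [ren, ihA, ihB]

theorem ren_ren (ρ τ : ℕ → ℕ) (t : Tm) : ren τ (ren ρ t) = ren (fun i => τ (ρ i)) t := by
  have hup : ∀ ρ τ : ℕ → ℕ, upRen (fun i => τ (ρ i)) = fun i => upRen τ (upRen ρ i) := by
    intro ρ τ; funext i; cases i <;> rfl
  induction t generalizing ρ τ with
  | var i => rfl
  | sort i => rfl
  | pi A B ihA ihB => simp only [ren, ihA, ihB, ← hup]
  | lam A B ihA ihB => simp only [ren, ihA, ihB, ← hup]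
  | app A B ihA ihB => simp only [ren, ihA, ihB]

theorem ren_eq_sub (ρ : ℕ → ℕ) (t : Tm) : ren ρ t = sub (fun i => .var (ρ i)) t := by
  have hup : ∀ ρ : ℕ → ℕ, up (fun i => .var (ρ i)) = fun i => .var (upRen ρ i) := by
    intro ρ; funext i; cases i <;> rfl
  induction t generalizing ρ with
  | var i => rfl
  | sort i => rfl
  | pi A B ihA ihB => simp only [ren, sub, ihA, ihB, hup]
  | lam A B ihA ihB => simp only [ren, sub, ihA, ihB, hup]
  | app A B ihA ihB => simp only [ren, sub, ihA, ihB]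

theorem sub_var (t : Tm) : sub Tm.var t = t :=
  (ren_eq_sub (fun i => i) t).symm.trans (ren_id t)

theorem sub_ren (ρ : ℕ → ℕ) (σ : ℕ → Tm) (t : Tm) :
    sub σ (ren ρ t) = sub (fun i => σ (ρ i)) t := by
  have hup : ∀ (ρ : ℕ → ℕ) (σ : ℕ → Tm), up (fun i => σ (ρ i)) = fun i => up σ (upRen ρ i) := by
    intro ρ σ; funext i; cases i <;> rfl
  induction t generalizing ρ σ with
  | var i => rfl
  | sort i => rfl
  | pi A B ihA ihB => simp only [ren, sub, ihA, ihB, ← hup]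
  | lam A B ihA ihB => simp only [ren, sub, ihA, ihB, ← hup]
  | app A B ihA ihB => simp only [ren, sub, ihA, ihB]

theorem ren_sub (σ : ℕ → Tm) (ρ : ℕ → ℕ) (t : Tm) :
    ren ρ (sub σ t) = sub (fun i => ren ρ (σ i)) t := by
  have hup : ∀ (ρ : ℕ → ℕ) (σ : ℕ → Tm),
      up (fun i => ren ρ (σ i)) = fun i => ren (upRen ρ) (up σ i) := by
    intro ρ σ
    funext i
    cases i with
    | zero => rfl
    | succ i => simp only [up, ren_ren]; rfl
  induction t generalizing ρ σ with
  | var i => rfl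
  | sort i => rfl
  | pi A B ihA ihB => simp only [ren, sub, ihA, ihB, hup]
  | lam A B ihA ihB => simp only [ren, sub, ihA, ihB, hup]
  | app A B ihA ihB => simp only [ren, sub, ihA, ihB]

theorem sub_sub (σ τ : ℕ → Tm) (t : Tm) : sub τ (sub σ t) = sub (fun i => sub τ (σ i)) t := by
  have hup : ∀ σ τ : ℕ → Tm, up (fun i => sub τ (σ i)) = fun i => sub (up τ) (up σ i) := by
    intro σ τ
    funext i
    cases i with
    | zero => rfl
    | succ i => simp only [up, ren_sub, sub_ren]
  induction t generalizing σ τ with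
  | var i => rfl
  | sort i => rfl
  | pi A B ihA ihB => simp only [sub, ihA, ihB, ← hup]
  | lam A B ihA ihB => simp only [sub, ihA, ihB, ← hup]
  | app A B ihA ihB => simp only [sub, ihA, ihB]

theorem subst_eq_sub (u : Tm) (k : ℕ) (t : Tm) :
    subst u k t =
      sub (fun i => if i < k then .var i else if i = k then lift k 0 u else .var (i - 1)) t := by
  have hup : ∀ k, (fun i => if i < k + 1 then Tm.var i else
      if i = k + 1 then lift (k + 1) 0 u else .var (i - 1)) =
      up (fun i => if i < k then .var i else if i = k then lift k 0 u else .var (i - 1)) := by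
    intro k
    funext i
    cases i with
    | zero => simp [up]
    | succ i =>
      simp only [up, Nat.add_lt_add_iff_right, Nat.add_right_cancel_iff]
      split_ifs with h1 h2
      · rfl
      · simp only [lift_zero_eq_ren, ren_ren]; rfl
      · simp only [ren, Nat.succ_eq_add_one]; congr 1; omega
  induction t generalizing k with
  | var i => rfl
  | sort i => rfl
  | pi A B ihA ihB => simp only [subst, sub, ihA, ihB, hup]
  | lam A B ihA ihB => simp only [subst, sub, ihA, ihB, hup]
  | app A B ihA ihB => simp only [subst, sub, ihA, ihB]

theorem subst_zero_eq_sub (u t : Tm) : subst u 0 t = sub (single u) t := by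
  rw [subst_eq_sub]
  congr 1
  funext i
  cases i with
  | zero => simp [single, lift_zero_eq_ren, ren_id]
  | succ i => simp [single]

theorem sub_subst (σ : ℕ → Tm) (u t : Tm) :
    sub σ (subst u 0 t) = subst (sub σ u) 0 (sub (up σ) t) := by
  simp only [subst_zero_eq_sub, sub_sub]
  congr 1
  funext i
  cases i with
  | zero => rfl
  | succ i => simp only [single, up, sub_ren]; exact (sub_var _).symm

theorem ren_subst (ρ : ℕ → ℕ) (u t : Tm) :
    ren ρ (subst u 0 t) = subst (ren ρ u) 0 (ren (upRen ρ) t) := by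
  simp only [subst_zero_eq_sub, ren_sub, sub_ren]
  congr 1
  funext i
  cases i <;> rfl

/-! ### Conversion -/

theorem Red.sub {t t' : Tm} (h : Red t t') (σ : ℕ → Tm) : Red (sub σ t) (CComega.sub σ t') := by
  induction h generalizing σ with
  | beta A t u => rw [sub_subst]; exact .beta _ _ _
  | piDom B _ ih => exact .piDom _ (ih _)
  | piCod A _ ih => exact .piCod _ (ih _)
  | lamDom t _ ih => exact .lamDom _ (ih _)
  | lamBody A _ ih => exact .lamBody _ (ih _)
  | appFun u _ ih => exact .appFun _ (ih _)
  | appArg t _ ih => exact .appArg _ (ih _)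

theorem Conv.refl (t : Tm) : Conv t t := Relation.EqvGen.refl t

theorem Conv.symm {t u : Tm} (h : Conv t u) : Conv u t := Relation.EqvGen.symm _ _ h

theorem Conv.trans {t u v : Tm} (h : Conv t u) (h' : Conv u v) : Conv t v :=
  Relation.EqvGen.trans _ _ _ h h'

theorem Red.conv {t u : Tm} (h : Red t u) : Conv t u := Relation.EqvGen.rel _ _ h

theorem Reds.conv {t u : Tm} (h : Reds t u) : Conv t u := by
  induction h with
  | refl => exact .refl _
  | tail _ h ih => exact ih.trans h.conv

theorem Conv.map {f : Tm → Tm} (hf : ∀ a b, Red a b → Red (f a) (f b)) {t u : Tm}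
    (h : Conv t u) : Conv (f t) (f u) := by
  induction h with
  | rel a b h => exact (hf a b h).conv
  | refl a => exact .refl _
  | symm a b _ ih => exact ih.symm
  | trans a b c _ _ ih ih' => exact ih.trans ih'

theorem Conv.sub {t u : Tm} (h : Conv t u) (σ : ℕ → Tm) : Conv (sub σ t) (CComega.sub σ u) :=
  h.map fun _ _ h => h.sub σ

theorem Conv.ren {t u : Tm} (h : Conv t u) (ρ : ℕ → ℕ) : Conv (ren ρ t) (CComega.ren ρ u) := by
  simpa only [ren_eq_sub] using h.sub _

theorem Conv.subst {t u : Tm} (h : Conv t u) (v : Tm) :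
    Conv (subst v 0 t) (CComega.subst v 0 u) := by
  simpa only [subst_zero_eq_sub] using h.sub _

theorem Conv.pi {A A' B B' : Tm} (hA : Conv A A') (hB : Conv B B') :
    Conv (.pi A B) (.pi A' B') :=
  (hA.map fun _ _ h => Red.piDom B h).trans (hB.map fun _ _ h => Red.piCod A' h)

theorem Conv.lam {A A' t t' : Tm} (hA : Conv A A') (ht : Conv t t') :
    Conv (.lam A t) (.lam A' t') :=
  (hA.map fun _ _ h => Red.lamDom t h).trans (ht.map fun _ _ h => Red.lamBody A' h)

theorem Conv.app {t t' u u' : Tm} (ht : Conv t t') (hu : Conv u u') :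
    Conv (.app t u) (.app t' u') :=
  (ht.map fun _ _ h => Red.appFun u h).trans (hu.map fun _ _ h => Red.appArg t' h)

/-! ### Parallel reduction and confluence -/

/-- Parallel reduction. -/
inductive Par : Tm → Tm → Prop
  | var (i : ℕ) : Par (.var i) (.var i)
  | sort (i : ℕ) : Par (.sort i) (.sort i)
  | pi {A A' B B'} : Par A A' → Par B B' → Par (.pi A B) (.pi A' B')
  | lam {A A' t t'} : Par A A' → Par t t' → Par (.lam A t) (.lam A' t')
  | app {t t' u u'} : Par t t' → Par u u' → Par (.app t u) (.app t' u')
  | beta (A : Tm) {t t' u u'} : Par t t' → Par u u' →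
      Par (.app (.lam A t) u) (subst u' 0 t')

theorem Par.refl (t : Tm) : Par t t := by
  induction t with
  | var i => exact .var i
  | sort i => exact .sort i
  | pi A B ihA ihB => exact .pi ihA ihB
  | lam A B ihA ihB => exact .lam ihA ihB
  | app A B ihA ihB => exact .app ihA ihB

theorem Red.par {t t' : Tm} (h : Red t t') : Par t t' := by
  induction h with
  | beta A t u => exact .beta A (.refl _) (.refl _)
  | piDom B _ ih => exact .pi ih (.refl _)
  | piCod A _ ih => exact .pi (.refl _) ih
  | lamDom t _ ih => exact .lam ih (.refl _)
  | lamBody A _ ih => exact .lam (.refl _) ih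
  | appFun u _ ih => exact .app ih (.refl _)
  | appArg t _ ih => exact .app (.refl _) ih

theorem Par.conv {t t' : Tm} (h : Par t t') : Conv t t' := by
  induction h with
  | var i => exact .refl _
  | sort i => exact .refl _
  | pi _ _ ih ih' => exact ih.pi ih'
  | lam _ _ ih ih' => exact ih.lam ih'
  | app _ _ ih ih' => exact ih.app ih'
  | beta A _ _ ih ih' => exact (((Conv.refl A).lam ih).app ih').trans (Red.beta _ _ _).conv

theorem Par.ren {t t' : Tm} (h : Par t t') (ρ : ℕ → ℕ) : Par (ren ρ t) (CComega.ren ρ t') := by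
  induction h generalizing ρ with
  | var i => exact .var _
  | sort i => exact .sort _
  | pi _ _ ih ih' => exact .pi (ih _) (ih' _)
  | lam _ _ ih ih' => exact .lam (ih _) (ih' _)
  | app _ _ ih ih' => exact .app (ih _) (ih' _)
  | beta A _ _ ih ih' => rw [ren_subst]; exact .beta _ (ih _) (ih' _)

theorem Par.up {σ τ : ℕ → Tm} (h : ∀ i, Par (σ i) (τ i)) (i : ℕ) :
    Par (up σ i) (CComega.up τ i) := by
  cases i with
  | zero => exact .var 0
  | succ i => exact (h i).ren _

theorem Par.sub {t t' : Tm} (h : Par t t') {σ τ : ℕ → Tm} (hσ : ∀ i, Par (σ i) (τ i)) :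
    Par (sub σ t) (CComega.sub τ t') := by
  induction h generalizing σ τ with
  | var i => exact hσ i
  | sort i => exact .sort _
  | pi _ _ ih ih' => exact .pi (ih hσ) (ih' (Par.up hσ))
  | lam _ _ ih ih' => exact .lam (ih hσ) (ih' (Par.up hσ))
  | app _ _ ih ih' => exact .app (ih hσ) (ih' hσ)
  | beta A _ _ ih ih' => rw [sub_subst]; exact .beta _ (ih (Par.up hσ)) (ih' hσ)

theorem Par.subst {t t' u u' : Tm} (ht : Par t t') (hu : Par u u') :
    Par (subst u 0 t) (CComega.subst u' 0 t') := by
  simp only [subst_zero_eq_sub]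
  refine ht.sub fun i => ?_
  cases i with
  | zero => exact hu
  | succ i => exact .var i

/-- Complete development: contraction of all the redexes of a term. -/
def dev : Tm → Tm
  | .var i => .var i
  | .sort i => .sort i
  | .pi A B => .pi (dev A) (dev B)
  | .lam A t => .lam (dev A) (dev t)
  | .app (.lam _ t) u => subst (dev u) 0 (dev t)
  | .app t u => .app (dev t) (dev u)

theorem Par.triangle {t t' : Tm} (h : Par t t') : Par t' (dev t) := by
  induction h with
  | var i => exact .var _
  | sort i => exact .sort _
  | pi _ _ ih ih' => exact .pi ih ih'
  | lam _ _ ih ih' => exact .lam ih ih'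
  | @app t t' u u' h _ ih ih' =>
    cases t with
    | lam A b =>
      cases h with
      | lam hA hb =>
        simp only [dev] at ih ⊢
        cases ih with
        | lam _ ihb => exact .beta _ ihb ih'
    | _ => exact .app ih ih'
  | beta A _ _ ih ih' => exact ih.subst ih'

theorem Conv.join {t u : Tm} (h : Conv t u) : Relation.Join (Relation.ReflTransGen Par) t u := by
  induction h with
  | rel a b h => exact ⟨b, .single h.par, .refl⟩
  | refl a => exact ⟨a, .refl, .refl⟩
  | symm a b _ ih => obtain ⟨c, h, h'⟩ := ih; exact ⟨c, h', h⟩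
  | trans a b c _ _ ih ih' =>
    obtain ⟨d, had, hbd⟩ := ih
    obtain ⟨e, hbe, hce⟩ := ih'
    obtain ⟨f, hdf, hef⟩ := Relation.church_rosser
      (fun t _ _ h h' => ⟨dev t, .single h.triangle, .single h'.triangle⟩) hbd hbe
    exact ⟨f, had.trans hdf, hce.trans hef⟩

theorem Par.pi_reducts {A B X : Tm} (h : Relation.ReflTransGen Par (.pi A B) X) :
    ∃ A' B', X = .pi A' B' ∧ Conv A A' ∧ Conv B B' := by
  induction h with
  | refl => exact ⟨A, B, rfl, .refl _, .refl _⟩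
  | tail _ h ih =>
    obtain ⟨A', B', rfl, hA, hB⟩ := ih
    cases h with
    | pi hA' hB' => exact ⟨_, _, rfl, hA.trans hA'.conv, hB.trans hB'.conv⟩

/-- Injectivity of products with respect to conversion. -/
theorem Conv.pi_inj {A A' B B' : Tm} (h : Conv (.pi A B) (.pi A' B')) :
    Conv A A' ∧ Conv B B' := by
  obtain ⟨X, h, h'⟩ := h.join
  obtain ⟨A₁, B₁, rfl, hA, hB⟩ := Par.pi_reducts h
  obtain ⟨A₂, B₂, heq, hA', hB'⟩ := Par.pi_reducts h'
  cases heq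
  exact ⟨hA.trans hA'.symm, hB.trans hB'.symm⟩

/-! ### Metatheory of undirected typing -/

/-- Induction on typing derivations, ignoring the context well-formedness derivations. -/
@[elab_as_elim]
theorem Typed.ind {P : ∀ Γ t T, Typed Γ t T → Prop}
    (sort : ∀ {Γ i} (h : WfCtx Γ), P Γ (.sort i) (.sort (i + 1)) (.sort h))
    (var : ∀ {Γ n A} (h : WfCtx Γ) (hn : Γ[n]? = some A),
      P Γ (.var n) (lift (n + 1) 0 A) (.var h hn))
    (pi : ∀ {Γ A B i j} (hA : Typed Γ A (.sort i)) (hB : Typed (A :: Γ) B (.sort j)),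
      P Γ A (.sort i) hA → P (A :: Γ) B (.sort j) hB →
      P Γ (.pi A B) (.sort (max i j)) (.pi hA hB))
    (lam : ∀ {Γ A B t i} (hP : Typed Γ (.pi A B) (.sort i)) (ht : Typed (A :: Γ) t B),
      P Γ (.pi A B) (.sort i) hP → P (A :: Γ) t B ht → P Γ (.lam A t) (.pi A B) (.lam hP ht))
    (app : ∀ {Γ t u A B} (ht : Typed Γ t (.pi A B)) (hu : Typed Γ u A),
      P Γ t (.pi A B) ht → P Γ u A hu → P Γ (.app t u) (subst u 0 B) (.app ht hu))
    (conv : ∀ {Γ t A B i} (ht : Typed Γ t A) (hB : Typed Γ B (.sort i)) (hc : Conv A B),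
      P Γ t A ht → P Γ B (.sort i) hB → P Γ t B (.conv ht hB hc))
    {Γ : Ctx} {t T : Tm} (h : Typed Γ t T) : P Γ t T h :=
  Typed.rec (motive_1 := fun _ _ => True) (motive_2 := P)
    trivial (fun _ _ _ _ => trivial) (fun h _ => sort h) (fun h h' _ => var h h')
    pi lam app conv h

theorem Typed.wfCtx {Γ : Ctx} {t T : Tm} (h : Typed Γ t T) : WfCtx Γ := by
  induction h using Typed.ind <;> assumption

theorem Typed.pi_inv {Γ : Ctx} {A B T : Tm} (h : Typed Γ (.pi A B) T) :
    ∃ i j, Typed Γ A (.sort i) ∧ Typed (A :: Γ) B (.sort j) := by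
  generalize ht : Tm.pi A B = t at h
  induction h using Typed.ind with
  | pi h h' => cases ht; exact ⟨_, _, h, h'⟩
  | conv _ _ _ ih => exact ih ht
  | _ => cases ht

theorem Typed.lam_inv {Γ : Ctx} {A t T : Tm} (h : Typed Γ (.lam A t) T) :
    ∃ B i, Typed Γ (.pi A B) (.sort i) ∧ Typed (A :: Γ) t B ∧ Conv (.pi A B) T := by
  generalize ht : Tm.lam A t = s at h
  induction h using Typed.ind with
  | lam h h' => cases ht; exact ⟨_, _, h, h', .refl _⟩
  | conv _ _ hc ih =>
    obtain ⟨B, i, h, h', hc'⟩ := ih ht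
    exact ⟨B, i, h, h', hc'.trans hc⟩
  | _ => cases ht

theorem Typed.ren {Γ : Ctx} {t T : Tm} (h : Typed Γ t T) {Δ : Ctx} (hΔ : WfCtx Δ) {ρ : ℕ → ℕ}
    (hρ : ∀ n A, Γ[n]? = some A → ∃ A', Δ[ρ n]? = some A' ∧
      lift (ρ n + 1) 0 A' = CComega.ren ρ (lift (n + 1) 0 A)) :
    Typed Δ (CComega.ren ρ t) (CComega.ren ρ T) := by
  have hup : ∀ {Γ Δ : Ctx} {ρ : ℕ → ℕ} (C : Tm), (∀ n A, Γ[n]? = some A → ∃ A', Δ[ρ n]? = some A' ∧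
      lift (ρ n + 1) 0 A' = CComega.ren ρ (lift (n + 1) 0 A)) →
      ∀ n A, (C :: Γ)[n]? = some A → ∃ A', (CComega.ren ρ C :: Δ)[upRen ρ n]? = some A' ∧
      lift (upRen ρ n + 1) 0 A' = CComega.ren (upRen ρ) (lift (n + 1) 0 A) := by
    intro Γ Δ ρ C hρ n A hn
    cases n with
    | zero =>
      cases hn
      refine ⟨_, rfl, ?_⟩
      simp only [lift_zero_eq_ren, ren_ren]
      rfl
    | succ n =>
      obtain ⟨A', h, h'⟩ := hρ n A hn
      refine ⟨A', h, ?_⟩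
      have := congrArg (CComega.ren Nat.succ) h'
      simp only [lift_zero_eq_ren, ren_ren] at this ⊢
      exact this
  induction h using Typed.ind generalizing Δ ρ with
  | sort => exact .sort hΔ
  | @var Γ n A _ hn =>
    obtain ⟨A', h, h'⟩ := hρ n A hn
    rw [← h']
    exact .var hΔ h
  | pi _ _ ih ih' =>
    have hA := ih hΔ hρ
    exact .pi hA (ih' (.cons hΔ hA) (hup _ hρ))
  | lam _ _ ih ih' =>
    have hP := ih hΔ hρ
    obtain ⟨_, _, hA, _⟩ := hP.pi_inv
    exact .lam hP (ih' (.cons hΔ hA) (hup _ hρ))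
  | app _ _ ih ih' => rw [ren_subst]; exact .app (ih hΔ hρ) (ih' hΔ hρ)
  | conv _ _ hc ih ih' => exact .conv (ih hΔ hρ) (ih' hΔ hρ) (hc.ren ρ)

theorem Typed.weaken {Γ : Ctx} {t T A : Tm} (h : Typed Γ t T) (hA : WfCtx (A :: Γ)) :
    Typed (A :: Γ) (CComega.ren Nat.succ t) (CComega.ren Nat.succ T) := by
  refine h.ren hA fun n B hn => ⟨B, hn, ?_⟩
  simp only [lift_zero_eq_ren, ren_ren]
  rfl

theorem Typed.sub {Γ : Ctx} {t T : Tm} (h : Typed Γ t T) {Δ : Ctx} (hΔ : WfCtx Δ) {σ : ℕ → Tm}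
    (hσ : ∀ n A, Γ[n]? = some A → Typed Δ (σ n) (CComega.sub σ (lift (n + 1) 0 A))) :
    Typed Δ (CComega.sub σ t) (CComega.sub σ T) := by
  have hup : ∀ {Γ Δ : Ctx} {σ : ℕ → Tm} {C : Tm}, WfCtx (CComega.sub σ C :: Δ) →
      (∀ n A, Γ[n]? = some A → Typed Δ (σ n) (CComega.sub σ (lift (n + 1) 0 A))) →
      ∀ n A, (C :: Γ)[n]? = some A →
        Typed (CComega.sub σ C :: Δ) (up σ n) (CComega.sub (up σ) (lift (n + 1) 0 A)) := by
    intro Γ Δ σ C hw hσ n A hn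
    cases n with
    | zero =>
      cases hn
      have := Typed.var (n := 0) hw rfl
      simp only [lift_zero_eq_ren, ren_sub, sub_ren] at this ⊢
      exact this
    | succ n =>
      have := (hσ n A hn).weaken hw
      simp only [lift_zero_eq_ren, ren_sub, sub_ren] at this ⊢
      exact this
  induction h using Typed.ind generalizing Δ σ with
  | sort => exact .sort hΔ
  | @var Γ n A _ hn => exact hσ n A hn
  | pi _ _ ih ih' =>
    have hA := ih hΔ hσ
    have hw := WfCtx.cons hΔ hA
    exact .pi hA (ih' hw (hup hw hσ))
  | lam _ _ ih ih' =>
    have hP := ih hΔ hσ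
    obtain ⟨_, _, hA, _⟩ := hP.pi_inv
    have hw := WfCtx.cons hΔ hA
    exact .lam hP (ih' hw (hup hw hσ))
  | app _ _ ih ih' => rw [sub_subst]; exact .app (ih hΔ hσ) (ih' hΔ hσ)
  | conv _ _ hc ih ih' => exact .conv (ih hΔ hσ) (ih' hΔ hσ) (hc.sub σ)

theorem sub_single_lift (u A : Tm) (n : ℕ) :
    sub (single u) (lift (n + 1) 0 A) = lift n 0 A := by
  simp only [lift_zero_eq_ren, sub_ren]
  exact (ren_eq_sub _ _).symm

theorem Typed.subst {Γ : Ctx} {t T u A : Tm} (h : Typed (A :: Γ) t T) (hu : Typed Γ u A) :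
    Typed Γ (subst u 0 t) (CComega.subst u 0 T) := by
  simp only [subst_zero_eq_sub]
  refine h.sub hu.wfCtx fun n B hn => ?_
  rw [sub_single_lift]
  cases n with
  | zero =>
    cases hn
    simpa [lift_zero_eq_ren, ren_id, single] using hu
  | succ n => exact .var hu.wfCtx hn

theorem Typed.ctx_conv {Γ : Ctx} {t T A A' : Tm} {i : ℕ} (h : Typed (A :: Γ) t T)
    (hA' : Typed Γ A' (.sort i)) (hc : Conv A A') : Typed (A' :: Γ) t T := by
  have hw : WfCtx (A' :: Γ) := .cons hA'.wfCtx hA'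
  rw [← sub_var t, ← sub_var T]
  refine h.sub hw fun n B hn => ?_
  rw [sub_var]
  cases n with
  | zero =>
    cases hn
    cases h.wfCtx with
    | cons _ hA =>
      have hA1 := hA.weaken hw
      have h0 := Typed.var (n := 0) hw rfl
      rw [lift_zero_eq_ren] at h0 ⊢
      exact .conv h0 hA1 (hc.symm.ren _)
  | succ n => exact .var hw hn

theorem WfCtx.lookup {Γ : Ctx} (hΓ : WfCtx Γ) {n : ℕ} {A : Tm} (hn : Γ[n]? = some A) :
    ∃ i, Typed Γ (lift (n + 1) 0 A) (.sort i) := by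
  induction Γ generalizing n with
  | nil => simp at hn
  | cons C Γ ih =>
    have hw := hΓ
    cases hΓ with
    | cons hΓ hC =>
      cases n with
      | zero =>
        cases hn
        rw [lift_zero_eq_ren]
        exact ⟨_, hC.weaken hw⟩
      | succ n =>
        obtain ⟨i, h⟩ := ih hΓ hn
        have := h.weaken hw
        rw [lift_zero_eq_ren, ren_ren] at this
        rw [lift_zero_eq_ren]
        exact ⟨i, this⟩

/-- Validity: the type of a well-typed term is well-typed. -/
theorem Typed.validity {Γ : Ctx} {t T : Tm} (h : Typed Γ t T) : ∃ i, Typed Γ T (.sort i) := by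
  induction h using Typed.ind with
  | sort h => exact ⟨_, .sort h⟩
  | var h hn => exact h.lookup hn
  | pi h _ => exact ⟨_, .sort h.wfCtx⟩
  | lam h _ => exact ⟨_, h⟩
  | app _ hu ih =>
    obtain ⟨_, hP⟩ := ih
    obtain ⟨_, j, _, hB⟩ := hP.pi_inv
    exact ⟨j, hB.subst hu⟩
  | conv _ h => exact ⟨_, h⟩

/-- Subject reduction. -/
theorem Typed.red {Γ : Ctx} {t t' T : Tm} (h : Typed Γ t T) (hr : Red t t') : Typed Γ t' T := by
  induction h using Typed.ind generalizing t' with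
  | sort => cases hr
  | var => cases hr
  | pi hA hB ihA ihB =>
    cases hr with
    | piDom _ hr => exact .pi (ihA hr) (hB.ctx_conv (ihA hr) hr.conv)
    | piCod _ hr => exact .pi hA (ihB hr)
  | lam hP ht ihP iht =>
    cases hr with
    | lamDom _ hr =>
      have hP' := ihP (.piDom _ hr)
      obtain ⟨_, _, hA', _⟩ := hP'.pi_inv
      exact .conv (.lam hP' (ht.ctx_conv hA' hr.conv)) hP (hr.conv.symm.pi (.refl _))
    | lamBody _ hr => exact .lam hP (iht hr)
  | app ht hu iht ihu =>
    obtain ⟨_, hP⟩ := ht.validity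
    obtain ⟨_, _, hA, hB⟩ := hP.pi_inv
    cases hr with
    | beta A₀ b u =>
      obtain ⟨B₀, _, hP₀, hb, hc⟩ := ht.lam_inv
      obtain ⟨_, _, hA₀, _⟩ := hP₀.pi_inv
      obtain ⟨hcA, hcB⟩ := hc.pi_inj
      exact .conv (hb.subst (.conv hu hA₀ hcA.symm)) (hB.subst hu) (hcB.subst _)
    | appFun _ hr => exact .app (iht hr) hu
    | appArg _ hr =>
      exact .conv (.app ht (ihu hr)) (hB.subst hu) ((Par.refl _).subst hr.par).conv.symm
  | conv _ hB hc ih => exact .conv (ih hr) hB hc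

theorem Typed.reds {Γ : Ctx} {t t' T : Tm} (h : Typed Γ t T) (hr : Reds t t') :
    Typed Γ t' T := by
  induction hr with
  | refl => exact h
  | tail _ hr ih => exact ih.red hr

theorem Typed.conv_reds {Γ : Ctx} {t T T' : Tm} (h : Typed Γ t T) (hr : Reds T T') :
    Typed Γ t T' := by
  obtain ⟨_, hT⟩ := h.validity
  exact .conv h (hT.reds hr) hr.conv

/-- **Correctness of bidirectional inference.** If `⊢ Γ` and `Γ ⊢ t ▹ T`
then `Γ ⊢ t : T`. -/
theorem infer_correct {Γ : Ctx} {t T : Tm} (hΓ : WfCtx Γ) (h : Infer Γ t T) :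
    Typed Γ t T := by
  induction h using Infer.rec
    (motive_2 := fun Γ t T _ => WfCtx Γ → (∃ i, Typed Γ T (.sort i)) → Typed Γ t T)
    (motive_3 := fun Γ t T _ => WfCtx Γ → Typed Γ t T)
    (motive_4 := fun Γ t T _ => WfCtx Γ → Typed Γ t T) with
  | sort => exact .sort hΓ
  | var hn => exact .var hΓ hn
  | pi _ _ ihA ihB =>
    have hA := ihA hΓ
    exact .pi hA (ihB (.cons hΓ hA))
  | lam _ _ ihA iht =>
    have hA := ihA hΓ
    have ht := iht (.cons hΓ hA)
    obtain ⟨_, hB⟩ := ht.validity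
    exact .lam (.pi hA hB) ht
  | app _ _ iht ihu =>
    have ht := iht hΓ
    obtain ⟨_, hP⟩ := ht.validity
    obtain ⟨_, _, hA, _⟩ := hP.pi_inv
    exact .app ht (ihu hΓ ⟨_, hA⟩)
  | check _ hc ih hΓ hT =>
    obtain ⟨_, hT⟩ := hT
    exact .conv (ih hΓ) hT hc
  | inferSort _ hr ih hΓ => exact (ih hΓ).conv_reds hr
  | inferPi _ hr ih hΓ => exact (ih hΓ).conv_reds hr

end CComega
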